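/- Every permutation of [n], n sufficiently large (in fact n ≥ 1 suffices with the stated bound), contains a pair of weak twins of length at least n/12. That is, wt(n) ≥ n/12 for large n. -/

import Mathlib

/-- `π` contains a pair of weak twins of length `w`: two subsequences on disjoint
position sets, of length `w` each, whose consecutive elements rise and fall in
the same way. -/
def HasWeakTwins {n : ℕ} (π : Equiv.Perm (Fin n)) (w : ℕ) : Prop :=
  ∃ a b : Fin w → Fin n, StrictMono a ∧ StrictMono b ∧ (∀ i j, a i ≠ b j) ∧
    ∀ i : ℕ, ∀ h : i + 1 < w,
      (π (a ⟨i, by omega⟩) < π (a ⟨i + 1, h⟩) ↔ π (b ⟨i, by omega⟩) < π (b ⟨i + 1, h⟩))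

def WTReach (f : ℕ → ℕ) (t p q : ℕ) : Prop :=
  ∃ a b : ℕ → ℕ, a t = p ∧ b t = q ∧
    (∀ i, i ≤ t → 6 * i ≤ a i ∧ a i < 6 * i + 6 ∧ 6 * i ≤ b i ∧ b i < 6 * i + 6 ∧ a i ≠ b i) ∧
    ∀ i, i < t → (f (a i) < f (a (i + 1)) ↔ f (b i) < f (b (i + 1)))

theorem wt_block (f : ℕ → ℕ) (hf : Function.Injective f) (t : ℕ) :
    ∃ e : Fin 6 → ℕ, (∀ i, 6 * t ≤ e i ∧ e i < 6 * t + 6) ∧ StrictMono (fun i => f (e i)) := by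
  have hc : ((Finset.Ico (6 * t) (6 * t + 6)).image f).card = 6 := by
    rw [Finset.card_image_of_injective _ hf]; simp
  have h : ∀ i, ∃ x, (6 * t ≤ x ∧ x < 6 * t + 6) ∧ f x = Finset.orderEmbOfFin _ hc i := by
    intro i
    have := Finset.orderEmbOfFin_mem _ hc i
    rw [Finset.mem_image] at this
    obtain ⟨x, hx, hx'⟩ := this
    exact ⟨x, Finset.mem_Ico.1 hx, hx'⟩
  choose e he he' using h
  refine ⟨e, he, fun i j hij => ?_⟩
  simp only [he']
  exact (Finset.orderEmbOfFin _ hc).strictMono hij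

theorem wt_zero (f : ℕ → ℕ) (p q : ℕ) (hp : p < 6) (hq : q < 6) (h : f p < f q) :
    WTReach f 0 p q := by
  have : p ≠ q := by rintro rfl; omega
  refine ⟨fun _ => p, fun _ => q, rfl, rfl, fun i hi => ?_, fun i hi => by omega⟩
  simp only
  omega

theorem wt_ext (f : ℕ → ℕ) (t p q p' q' : ℕ) (hr : WTReach f t p q)
    (hp : 6 * (t + 1) ≤ p' ∧ p' < 6 * (t + 1) + 6)
    (hq : 6 * (t + 1) ≤ q' ∧ q' < 6 * (t + 1) + 6) (h : f p' < f q')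
    (hg : f p < f p' ↔ f q < f q') : WTReach f (t + 1) p' q' := by
  have hne : p' ≠ q' := by rintro rfl; omega
  obtain ⟨a, b, rfl, rfl, h1, h2⟩ := hr
  refine ⟨fun i => if i ≤ t then a i else p', fun i => if i ≤ t then b i else q',
    by simp, by simp, fun i hi => ?_, fun i hi => ?_⟩
  · by_cases hit : i ≤ t
    · simpa [hit] using h1 i hit
    · obtain rfl : i = t + 1 := by omega
      simp only [hit, if_false]
      exact ⟨hp.1, hp.2, hq.1, hq.2, hne⟩
  · by_cases hit : i < t
    · have e1 : i ≤ t := by omega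
      have e2 : i + 1 ≤ t := by omega
      simpa [e1, e2] using h2 i hit
    · obtain rfl : i = t := by omega
      simpa using hg

theorem wt_main (f : ℕ → ℕ) (hf : Function.Injective f) (t : ℕ) :
    ∃ p q r s, f p < f q ∧ f q < f r ∧ f r < f s ∧ WTReach f t p q ∧ WTReach f t r s := by
  induction t with
  | zero =>
    obtain ⟨e, he, hm⟩ := wt_block f hf 0
    have h01 : f (e 0) < f (e 1) := hm (by decide)
    have h12 : f (e 1) < f (e 2) := hm (by decide)
    have h23 : f (e 2) < f (e 3) := hm (by decide)
    have hb : ∀ i, e i < 6 := fun i => by have := he i; omega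
    exact ⟨e 0, e 1, e 2, e 3, h01, h12, h23, wt_zero f _ _ (hb _) (hb _) h01,
      wt_zero f _ _ (hb _) (hb _) h23⟩
  | succ t ih =>
    obtain ⟨p, q, r, s, hpq, hqr, hrs, R1, R2⟩ := ih
    obtain ⟨e, he, hm⟩ := wt_block f hf (t + 1)
    have h01 : f (e 0) < f (e 1) := hm (by decide)
    have h12 : f (e 1) < f (e 2) := hm (by decide)
    have h23 : f (e 2) < f (e 3) := hm (by decide)
    have h34 : f (e 3) < f (e 4) := hm (by decide)
    have h45 : f (e 4) < f (e 5) := hm (by decide)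
    have key : ∀ i j, f (e i) < f (e j) → WTReach f (t + 1) (e i) (e j) ∨
        (f (e i) ≤ f p ∧ f s < f (e j)) := by
      intro i j hij
      by_cases g1 : f p < f (e i) ↔ f q < f (e j)
      · exact Or.inl (wt_ext f t _ _ _ _ R1 (he i) (he j) hij g1)
      by_cases g2 : f r < f (e i) ↔ f s < f (e j)
      · exact Or.inl (wt_ext f t _ _ _ _ R2 (he i) (he j) hij g2)
      right
      omega
    rcases key 0 1 h01 with A | A
    · rcases key 2 3 h23 with B | B
      · exact ⟨_, _, _, _, h01, h12, h23, A, B⟩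
      · rcases key 4 5 h45 with C | C
        · exact ⟨_, _, _, _, h01, by omega, h45, A, C⟩
        · omega
    · rcases key 2 3 h23 with B | B
      · rcases key 4 5 h45 with C | C
        · exact ⟨_, _, _, _, h23, h34, h45, B, C⟩
        · omega
      · omega

/-- Lower bound: for large `n`, every permutation of `[n]` contains weak twins of
length at least `n/12`. -/
theorem stmt_4 : ∃ n₀ : ℕ, ∀ n : ℕ, n₀ ≤ n → ∀ π : Equiv.Perm (Fin n),
    ∃ w : ℕ, (n : ℝ) / 12 ≤ w ∧ HasWeakTwins π w := by
  refine ⟨6, fun n hn π => ?_⟩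
  obtain ⟨t, ht⟩ : ∃ t, n / 6 = t + 1 := ⟨n / 6 - 1, by omega⟩
  refine ⟨t + 1, ?_, ?_⟩
  · have : n ≤ 12 * (t + 1) := by omega
    have h : (n : ℝ) ≤ 12 * ((t + 1 : ℕ) : ℝ) := by exact_mod_cast this
    linarith
  let f : ℕ → ℕ := fun i => if h : i < n then (π ⟨i, h⟩ : ℕ) else i
  have fv : ∀ i (h : i < n), f i = (π ⟨i, h⟩ : ℕ) := fun i h => by simp [f, h]
  have fv' : ∀ i, ¬ i < n → f i = i := fun i h => by simp [f, h]
  have hf : Function.Injective f := by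
    intro i j hij
    by_cases hi : i < n <;> by_cases hj : j < n
    · rw [fv i hi, fv j hj] at hij
      simpa using π.injective (Fin.ext hij)
    · rw [fv i hi, fv' j hj] at hij
      have := (π ⟨i, hi⟩).2
      omega
    · rw [fv' i hi, fv j hj] at hij
      have := (π ⟨j, hj⟩).2
      omega
    · rwa [fv' i hi, fv' j hj] at hij
  obtain ⟨p, q, -, -, -, -, -, ⟨a, b, -, -, h1, h2⟩, -⟩ := wt_main f hf t
  have ha : ∀ i, i < t + 1 → a i < n := fun i hi => by have := h1 i (by omega); omega
  have hb : ∀ i, i < t + 1 → b i < n := fun i hi => by have := h1 i (by omega); omega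
  refine ⟨fun i => ⟨a i, ha i i.2⟩, fun i => ⟨b i, hb i i.2⟩, ?_, ?_, ?_, ?_⟩
  · intro i j hij
    have := h1 i (by omega)
    have := h1 j (by omega)
    have : (i : ℕ) < j := hij
    show a i < a j
    omega
  · intro i j hij
    have := h1 i (by omega)
    have := h1 j (by omega)
    have : (i : ℕ) < j := hij
    show b i < b j
    omega
  · intro i j h
    have h' : a i = b j := congrArg Fin.val h
    have k1 := h1 i (by omega)
    have k2 := h1 j (by omega)
    have e : (i : ℕ) = j := by omega
    rw [e] at h' k1
    omega
  · intro i hi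
    have := h2 i (by omega)
    rw [fv _ (ha i (by omega)), fv _ (ha (i + 1) hi), fv _ (hb i (by omega)),
      fv _ (hb (i + 1) hi)] at this
    exact this
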